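/- Let X be a finite poset, let b be a maximal element of X, and suppose there exists a ∈ X with F̂_a = {b} and such that Û_b ∖ {a} has trivial reduced f-homology in every degree. Then H^f_n(X, X ∖ {a,b}) = 0 for all n ∈ ℤ. -/

import Mathlib

open scoped Classical

universe u

section ChainComplexes

variable (α : Type u) [PartialOrder α]

/-- The chains of the subposet `S` of `α` (encoded as finsets of `α` contained in `S` that are
totally ordered) having cardinality `n + 1`.  For `n = -1` this contains only the empty chain.
This is the canonical basis of the degree-`n` part of the reduced f-chain complex of `S`. -/
def RChains (S : Set α) (n : ℤ) : Type u :=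
  {s : Finset α // (↑s : Set α) ⊆ S ∧ IsChain (· ≤ ·) (↑s : Set α) ∧ (s.card : ℤ) = n + 1}

/-- The degree-`n` part of the reduced f-chain complex of the subposet `S`:
the free abelian group on the chains of `S` of cardinality `n + 1`
(including the empty chain in degree `-1`). -/
abbrev RCgrp (S : Set α) (n : ℤ) : Type u := RChains α S n →₀ ℤ

/-- The sign `sgn_s(v)`: `(-1) ^ k` where `v` is the `(k+1)`-st smallest element of `s`. -/
noncomputable def chainSgn (s : Finset α) (v : α) : ℤ :=
  (-1) ^ (s.filter fun a => a < v).card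

theorem erase_spec {S : Set α} {n : ℤ} {s : Finset α} (hsub : (↑s : Set α) ⊆ S)
    (hch : IsChain (· ≤ ·) (↑s : Set α)) (hcard : (s.card : ℤ) = n + 1) {v : α} (hv : v ∈ s) :
    (↑(s.erase v) : Set α) ⊆ S ∧ IsChain (· ≤ ·) (↑(s.erase v) : Set α) ∧
      ((s.erase v).card : ℤ) = (n - 1) + 1 := by
  refine ⟨fun x hx => hsub (Finset.coe_subset.mpr (Finset.erase_subset _ _) hx),
    IsChain.mono (Finset.coe_subset.mpr (Finset.erase_subset _ _)) hch, ?_⟩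
  rw [Finset.cast_card_erase_of_mem hv, hcard]; ring

/-- The differential of the reduced f-chain complex of the subposet `S`. -/
noncomputable def rd (S : Set α) (n : ℤ) : RCgrp α S n →+ RCgrp α S (n - 1) :=
  ((Finsupp.lift (RCgrp α S (n - 1)) ℤ (RChains α S n)) (fun s =>
    ∑ v ∈ s.1.attach,
      chainSgn α s.1 v.1 •
        Finsupp.single
          (⟨s.1.erase v.1, erase_spec α s.2.1 s.2.2.1 s.2.2.2 v.2⟩ : RChains α S (n - 1))
          (1 : ℤ))).toAddMonoidHom

/-- The chains of the subposet `S` of cardinality `n + 1` that are not contained in `A`: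
the canonical basis of the degree-`n` part of the relative f-chain complex
`C^f(S, A) = C^f(S)/C^f(A)`. -/
def FChains (S A : Set α) (n : ℤ) : Type u :=
  {s : Finset α // (↑s : Set α) ⊆ S ∧ IsChain (· ≤ ·) (↑s : Set α) ∧ (s.card : ℤ) = n + 1 ∧
      ¬(↑s : Set α) ⊆ A}

/-- The degree-`n` part of the relative f-chain complex `C^f(S, A) = C^f(S)/C^f(A)`,
realized as the free abelian group on the chains of `S` not contained in `A`. -/
abbrev FCgrp (S A : Set α) (n : ℤ) : Type u := FChains α S A n →₀ ℤ

/-- The differential of the relative f-chain complex `C^f(S, A)`. -/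
noncomputable def fd (S A : Set α) (n : ℤ) : FCgrp α S A n →+ FCgrp α S A (n - 1) :=
  ((Finsupp.lift (FCgrp α S A (n - 1)) ℤ (FChains α S A n)) (fun s =>
    ∑ v ∈ s.1.attach,
      chainSgn α s.1 v.1 •
        (if h : ¬(↑(s.1.erase v.1) : Set α) ⊆ A then
          Finsupp.single
            (⟨s.1.erase v.1,
              ⟨(erase_spec α s.2.1 s.2.2.1 s.2.2.2.1 v.2).1,
                (erase_spec α s.2.1 s.2.2.1 s.2.2.2.1 v.2).2.1,
                (erase_spec α s.2.1 s.2.2.1 s.2.2.2.1 v.2).2.2, h⟩⟩ : FChains α S A (n - 1))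
            (1 : ℤ)
         else 0))).toAddMonoidHom

end ChainComplexes

section GradedHomology

/-- Transport along an equality of degrees. -/
def castAddEquiv (G : ℤ → Type*) [∀ n, AddCommGroup (G n)] {m n : ℤ} (h : m = n) :
    G m ≃+ G n := by subst h; exact AddEquiv.refl _

/-- The group of `n`-boundaries of a graded group `G` with degree `-1` maps `d`. -/
noncomputable def boundariesOf (G : ℤ → Type*) [∀ n, AddCommGroup (G n)]
    (d : (n : ℤ) → G n →+ G (n - 1)) (n : ℤ) : AddSubgroup (G n) :=
  AddSubgroup.map (castAddEquiv G (show n + 1 - 1 = n by ring)).toAddMonoidHom (d (n + 1)).range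

/-- The `n`-th homology group of a graded abelian group `G` equipped with degree `-1`
homomorphisms `d` (cycles modulo boundaries; when `d ∘ d = 0` this is the usual homology). -/
noncomputable def gradedHomology (G : ℤ → Type*) [∀ n, AddCommGroup (G n)]
    (d : (n : ℤ) → G n →+ G (n - 1)) (n : ℤ) : Type _ :=
  (d n).ker ⧸ ((boundariesOf G d n).addSubgroupOf (d n).ker)

noncomputable instance (G : ℤ → Type*) [∀ n, AddCommGroup (G n)]
    (d : (n : ℤ) → G n →+ G (n - 1)) (n : ℤ) : AddCommGroup (gradedHomology G d n) :=
  inferInstanceAs (AddCommGroup (_ ⧸ _))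

end GradedHomology

section Homology

variable (α : Type u) [PartialOrder α]

/-- The `n`-th reduced f-homology group `H̃^f_n(S)` of the subposet `S`. -/
noncomputable def RH (S : Set α) (n : ℤ) : Type u :=
  gradedHomology (RCgrp α S) (rd α S) n

noncomputable instance (S : Set α) (n : ℤ) : AddCommGroup (RH α S n) :=
  inferInstanceAs (AddCommGroup (gradedHomology _ _ _))

/-- The `n`-th relative f-homology group `H^f_n(S, A)`. -/
noncomputable def FH (S A : Set α) (n : ℤ) : Type u :=
  gradedHomology (FCgrp α S A) (fd α S A) n

noncomputable instance (S A : Set α) (n : ℤ) : AddCommGroup (FH α S A n) :=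
  inferInstanceAs (AddCommGroup (gradedHomology _ _ _))

/-- The `n`-th (unreduced) f-homology group `H^f_n(S)` of the subposet `S`,
i.e. the homology of the complex freely generated by the nonempty chains of `S`. -/
noncomputable def HF (S : Set α) (n : ℤ) : Type u := FH α S ∅ n

noncomputable instance (S : Set α) (n : ℤ) : AddCommGroup (HF α S n) :=
  inferInstanceAs (AddCommGroup (FH α S ∅ n))

end Homology

section Helpers

variable {α : Type u} [PartialOrder α]

def PR (S : Set α) (n : ℤ) (s : Finset α) : Prop :=
  (↑s : Set α) ⊆ S ∧ IsChain (· ≤ ·) (↑s : Set α) ∧ (s.card : ℤ) = n + 1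

def PF (S A : Set α) (n : ℤ) (s : Finset α) : Prop :=
  (↑s : Set α) ⊆ S ∧ IsChain (· ≤ ·) (↑s : Set α) ∧ (s.card : ℤ) = n + 1 ∧
      ¬(↑s : Set α) ⊆ A

noncomputable def bd [Fintype α] (f : Finset α → ℤ) (t : Finset α) : ℤ :=
  ∑ v : α, if v ∉ t then chainSgn α t v * f (insert v t) else 0

def mkR {S : Set α} {n : ℤ} (s : Finset α) (h : PR S n s) : RChains α S n := ⟨s, h⟩

def mkF {S A : Set α} {n : ℤ} (s : Finset α) (h : PF S A n s) : FChains α S A n := ⟨s, h⟩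

def vR {S : Set α} {n : ℤ} (s : RChains α S n) : Finset α := s.1

def vF {S A : Set α} {n : ℤ} (s : FChains α S A n) : Finset α := s.1

theorem pR {S : Set α} {n : ℤ} (s : RChains α S n) : PR S n (vR s) := s.2

theorem pF {S A : Set α} {n : ℤ} (s : FChains α S A n) : PF S A n (vF s) := s.2

theorem mkR_eq {S : Set α} {n : ℤ} (s : Finset α) (h : PR S n s) (t : RChains α S n) :
    mkR s h = t ↔ s = vR t := Subtype.ext_iff

theorem mkF_eq {S A : Set α} {n : ℤ} (s : Finset α) (h : PF S A n s) (t : FChains α S A n) :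
    mkF s h = t ↔ s = vF t := Subtype.ext_iff

theorem lift_single' {X M : Type*} [AddCommGroup M] (F : X → M) (s : X) (c : ℤ) :
    ((Finsupp.lift M ℤ X) F).toAddMonoidHom (Finsupp.single s c) = c • F s := by
  simp [Finsupp.lift_apply]

theorem eval_sum {X I : Type*} (A : Finset I) (z : I → ℤ) (F : I → X →₀ ℤ) (c : ℤ) (t : X) :
    (c • ∑ i ∈ A, z i • F i) t = ∑ i ∈ A, z i * (c * F i t) := by
  rw [Finsupp.smul_apply, Finsupp.finsetSum_apply, smul_eq_mul, Finset.mul_sum]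
  refine Finset.sum_congr rfl fun v _ => ?_
  rw [Finsupp.smul_apply, smul_eq_mul]; ring

noncomputable def extR {S : Set α} {n : ℤ} (x : RCgrp α S n) (s : Finset α) : ℤ :=
  if h : PR S n s then x (mkR s h) else 0

noncomputable def extF {S A : Set α} {n : ℤ} (x : FCgrp α S A n) (s : Finset α) : ℤ :=
  if h : PF S A n s then x (mkF s h) else 0

theorem extR_cast {S : Set α} {m n : ℤ} (h : m = n) (x : RCgrp α S m) :
    extR (castAddEquiv (RCgrp α S) h x) = extR x := by
  subst h; rfl

theorem extF_cast {S A : Set α} {m n : ℤ} (h : m = n) (x : FCgrp α S A m) :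
    extF (castAddEquiv (FCgrp α S A) h x) = extF x := by
  subst h; rfl

theorem sgn_insert_self (t : Finset α) (v : α) : chainSgn α (insert v t) v = chainSgn α t v := by
  unfold chainSgn
  rw [Finset.filter_insert, if_neg (lt_irrefl v)]

theorem sgn_insert (t : Finset α) (v w : α) (hv : v ∉ t) :
    chainSgn α (insert v t) w = chainSgn α t w * (if v < w then -1 else 1) := by
  unfold chainSgn
  rw [Finset.filter_insert]
  split_ifs with h
  · rw [Finset.card_insert_of_notMem (by simp [hv]), pow_succ]
  · simp

theorem bd_add [Fintype α] (f g : Finset α → ℤ) (t : Finset α) :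
    bd (fun s => f s + g s) t = bd f t + bd g t := by
  unfold bd
  rw [← Finset.sum_add_distrib]
  refine Finset.sum_congr rfl fun v _ => ?_
  split_ifs <;> ring

theorem bd_sub [Fintype α] (f g : Finset α → ℤ) (t : Finset α) :
    bd (fun s => f s - g s) t = bd f t - bd g t := by
  unfold bd
  rw [← Finset.sum_sub_distrib]
  refine Finset.sum_congr rfl fun v _ => ?_
  split_ifs <;> ring

theorem bd_bd [Fintype α] (f : Finset α → ℤ)
    (hf : ∀ s, f s ≠ 0 → IsChain (· ≤ ·) (↑s : Set α)) (t : Finset α) :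
    bd (bd f) t = 0 := by
  have key : bd (bd f) t = ∑ v : α, ∑ w : α, if v ∉ t ∧ w ∉ t ∧ v ≠ w then
      chainSgn α t v * chainSgn α t w * (if v < w then -1 else 1) * f (insert w (insert v t))
      else 0 := by
    unfold bd
    refine Finset.sum_congr rfl fun v _ => ?_
    by_cases hv : v ∈ t
    · simp [hv]
    · rw [if_pos hv, Finset.mul_sum]
      refine Finset.sum_congr rfl fun w _ => ?_
      by_cases hw : w ∈ t
      · simp [hw]
      · by_cases hvw : v = w
        · simp [hvw]
        · have : w ≠ v := fun h => hvw h.symm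
          simp only [Finset.mem_insert, hw, hv, this, hvw, or_self, not_false_eq_true, if_true,
            true_and, ne_eq, sgn_insert t v w hv]
          ring
  have anti : bd (bd f) t = - bd (bd f) t := by
    conv_rhs => rw [key, Finset.sum_comm]
    rw [key, ← Finset.sum_neg_distrib]
    refine Finset.sum_congr rfl fun v _ => ?_
    rw [← Finset.sum_neg_distrib]
    refine Finset.sum_congr rfl fun w _ => ?_
    by_cases h : v ∉ t ∧ w ∉ t ∧ v ≠ w
    · rw [if_pos h, if_pos (show w ∉ t ∧ v ∉ t ∧ w ≠ v from ⟨h.2.1, h.1, h.2.2.symm⟩), Finset.insert_comm v w t]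
      by_cases h0 : f (insert w (insert v t)) = 0
      · rw [h0]; ring
      · have hc := hf _ h0
        have := hc (x := v) (by simp) (y := w) (by simp) h.2.2
        rcases this with h1 | h1
        · have h2 := lt_of_le_of_ne h1 h.2.2
          rw [if_pos h2, if_neg h2.asymm]; ring
        · have h2 := lt_of_le_of_ne h1 h.2.2.symm
          rw [if_pos h2, if_neg h2.asymm]; ring
    · rw [if_neg h, if_neg (fun h' => h ⟨h'.2.1, h'.1, h'.2.2.symm⟩)]; simp
  linarith

theorem sum_aux [Fintype α] (s t : Finset α) (c : ℤ) :
    (∑ v ∈ s.attach, chainSgn α s v.1 * (if s.erase v.1 = t then c else 0)) =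
      bd (fun r => if r = s then c else 0) t := by
  unfold bd
  rw [Finset.sum_attach s (fun v => chainSgn α s v * (if s.erase v = t then c else 0)),
    ← Finset.sum_subset (Finset.subset_univ s)]
  · refine Finset.sum_congr rfl fun v hv => ?_
    by_cases h : s.erase v = t
    · subst h
      have := sgn_insert_self (s.erase v) v
      rw [Finset.insert_erase hv] at this
      simp [Finset.insert_erase hv, this]
    · rw [if_neg h]
      by_cases h1 : v ∈ t
      · simp [h1]
      · have h3 : insert v t ≠ s := fun h2 => h (by rw [← h2, Finset.erase_insert h1])
        simp [h3]
  · intro v _ hv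
    have h3 : insert v t ≠ s := fun h2 => hv (h2 ▸ Finset.mem_insert_self v t)
    simp [h3]

theorem extR_single {S : Set α} {n : ℤ} (s : RChains α S n) (c : ℤ) :
    extR (Finsupp.single s c : RCgrp α S n) = fun r => if r = vR s then c else 0 := by
  funext r
  unfold extR
  by_cases h : PR S n r
  · rw [dif_pos h, Finsupp.single_apply]
    refine if_congr ?_ rfl rfl
    rw [eq_comm, mkR_eq]
  · rw [dif_neg h, if_neg]
    rintro rfl
    exact h (pR s)

theorem extF_single {S A : Set α} {n : ℤ} (s : FChains α S A n) (c : ℤ) :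
    extF (Finsupp.single s c : FCgrp α S A n) = fun r => if r = vF s then c else 0 := by
  funext r
  unfold extF
  by_cases h : PF S A n r
  · rw [dif_pos h, Finsupp.single_apply]
    refine if_congr ?_ rfl rfl
    rw [eq_comm, mkF_eq]
  · rw [dif_neg h, if_neg]
    rintro rfl
    exact h (pF s)

theorem extR_add {S : Set α} {n : ℤ} (x y : RCgrp α S n) :
    extR (x + y) = fun s => extR x s + extR y s := by
  funext s; unfold extR; split_ifs <;> simp

theorem extF_add {S A : Set α} {n : ℤ} (x y : FCgrp α S A n) :
    extF (x + y) = fun s => extF x s + extF y s := by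
  funext s; unfold extF; split_ifs <;> simp

theorem rd_single {S : Set α} {n : ℤ} (s : RChains α S n) (c : ℤ) :
    rd α S n (Finsupp.single s c) = c • ∑ v ∈ (vR s).attach, chainSgn α (vR s) v.1 •
      Finsupp.single (mkR ((vR s).erase v.1)
        (erase_spec α (pR s).1 (pR s).2.1 (pR s).2.2 v.2) : RChains α S (n - 1)) (1 : ℤ) :=
  lift_single' _ s c

theorem fd_single {S A : Set α} {n : ℤ} (s : FChains α S A n) (c : ℤ) :
    fd α S A n (Finsupp.single s c) = c • ∑ v ∈ (vF s).attach, chainSgn α (vF s) v.1 •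
      (if h : ¬(↑((vF s).erase v.1) : Set α) ⊆ A then
        Finsupp.single (mkF ((vF s).erase v.1)
          ⟨(erase_spec α (pF s).1 (pF s).2.1 (pF s).2.2.1 v.2).1,
            (erase_spec α (pF s).1 (pF s).2.1 (pF s).2.2.1 v.2).2.1,
            (erase_spec α (pF s).1 (pF s).2.1 (pF s).2.2.1 v.2).2.2, h⟩ : FChains α S A (n - 1))
          (1 : ℤ)
        else 0) :=
  lift_single' _ s c

theorem rd_apply [Fintype α] {S : Set α} {n : ℤ} (x : RCgrp α S n) (t : RChains α S (n - 1)) :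
    rd α S n x t = bd (extR x) (vR t) := by
  induction x using Finsupp.induction_linear with
  | zero =>
    have : extR (0 : RCgrp α S n) = fun _ => 0 := by funext s; simp [extR]
    rw [this]; simp [bd]
  | add f g hf hg =>
    rw [map_add, extR_add, bd_add, Finsupp.add_apply, hf, hg]
  | single s c =>
    rw [extR_single, ← sum_aux, rd_single, eval_sum]
    refine Finset.sum_congr rfl fun v _ => ?_
    rw [Finsupp.single_apply]
    split_ifs with h1 h2 h2
    · ring
    · exact absurd ((mkR_eq _ _ _).1 h1) h2
    · exact absurd ((mkR_eq _ _ _).2 h2) h1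
    · ring

theorem fd_apply [Fintype α] {S A : Set α} {n : ℤ} (x : FCgrp α S A n)
    (t : FChains α S A (n - 1)) :
    fd α S A n x t = bd (extF x) (vF t) := by
  induction x using Finsupp.induction_linear with
  | zero =>
    have : extF (0 : FCgrp α S A n) = fun _ => 0 := by funext s; simp [extF]
    rw [this]; simp [bd]
  | add f g hf hg =>
    rw [map_add, extF_add, bd_add, Finsupp.add_apply, hf, hg]
  | single s c =>
    rw [extF_single, ← sum_aux, fd_single, eval_sum]
    refine Finset.sum_congr rfl fun v _ => ?_
    by_cases h : ¬(↑((vF s).erase v.1) : Set α) ⊆ A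
    · rw [dif_pos h]
      rw [Finsupp.single_apply]
      split_ifs with h1 h2 h2
      · ring
      · exact absurd ((mkF_eq _ _ _).1 h1) h2
      · exact absurd ((mkF_eq _ _ _).2 h2) h1
      · ring
    · rw [dif_neg h, if_neg]
      · simp
      · intro h'
        exact h (h' ▸ (pF t).2.2.2)

theorem gh_iff (G : ℤ → Type*) [∀ n, AddCommGroup (G n)]
    (d : (n : ℤ) → G n →+ G (n - 1)) (n : ℤ) : Subsingleton (gradedHomology G d n) ↔
    ∀ x, d n x = 0 → ∃ y, castAddEquiv G (show n + 1 - 1 = n by ring) (d (n + 1) y) = x := by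
  unfold gradedHomology
  rw [QuotientAddGroup.subsingleton_iff, AddSubgroup.addSubgroupOf_eq_top]
  unfold boundariesOf
  constructor
  · intro h x hx
    obtain ⟨_, ⟨y, rfl⟩, hy⟩ := h (show x ∈ (d n).ker from hx)
    exact ⟨y, hy⟩
  · intro h x hx
    obtain ⟨y, hy⟩ := h x hx
    exact ⟨_, ⟨y, rfl⟩, hy⟩

theorem FH_of [Fintype α] {S A : Set α} {n : ℤ}
    (H : ∀ f : Finset α → ℤ, (∀ s, f s ≠ 0 → PF S A n s) →
      (∀ t, PF S A (n - 1) t → bd f t = 0) →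
      ∃ g : Finset α → ℤ, (∀ s, g s ≠ 0 → PF S A (n + 1) s) ∧ ∀ t, PF S A n t → bd g t = f t) :
    Subsingleton (FH α S A n) := by
  refine (gh_iff _ _ _).2 fun x hx => ?_
  obtain ⟨g, hg, hg'⟩ := H (extF x) (fun s hs => by
    by_contra h; exact hs (dif_neg h)) (fun t ht => by
      refine (fd_apply x (mkF t ht)).symm.trans ?_
      rw [hx]; rfl)
  have : Finite (FChains α S A (n + 1)) := Subtype.finite
  refine ⟨Finsupp.equivFunOnFinite.symm (fun s => g (vF s)), ?_⟩
  have he : extF (Finsupp.equivFunOnFinite.symm (fun s => g (vF s)) : FCgrp α S A (n + 1)) = g := by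
    funext s
    unfold extF
    split_ifs with h
    · rfl
    · by_contra h'
      exact h (hg s (Ne.symm h'))
  set y : FCgrp α S A (n + 1) := Finsupp.equivFunOnFinite.symm (fun s => g (vF s))
  have hn : n + 1 - 1 = n := by ring
  ext t
  have h1 := congrFun (extF_cast hn (fd α S A (n + 1) y)) (vF t)
  have h2 : PF S A n (vF t) := pF t
  have h3 : PF S A (n + 1 - 1) (vF t) := by rw [hn]; exact h2
  have h4 := hg' (vF t) h2
  rw [extF, dif_pos h2, extF, dif_pos h3, fd_apply, he] at h1
  rw [extF, dif_pos h2] at h4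
  exact h1.trans h4

theorem of_RH [Fintype α] {S : Set α} {n : ℤ} (H : Subsingleton (RH α S n))
    (f : Finset α → ℤ) (hf : ∀ s, f s ≠ 0 → PR S n s)
    (hc : ∀ t, PR S (n - 1) t → bd f t = 0) :
    ∃ g : Finset α → ℤ, (∀ s, g s ≠ 0 → PR S (n + 1) s) ∧ ∀ t, PR S n t → bd g t = f t := by
  have : Finite (RChains α S n) := Subtype.finite
  have he : extR (Finsupp.equivFunOnFinite.symm (fun s => f (vR s)) : RCgrp α S n) = f := by
    funext s
    unfold extR
    split_ifs with h
    · rfl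
    · by_contra h'
      exact h (hf s (Ne.symm h'))
  set x : RCgrp α S n := Finsupp.equivFunOnFinite.symm (fun s => f (vR s))
  obtain ⟨y, hy⟩ := (gh_iff _ _ _).1 H x (by
    ext t
    rw [rd_apply, he, hc _ (pR t)]; rfl)
  refine ⟨extR y, fun s hs => by by_contra h; exact hs (dif_neg h), fun t h2 => ?_⟩
  have hn : n + 1 - 1 = n := by ring
  have h1 := congrFun (extR_cast hn (rd α S (n + 1) y)) t
  have h3 : PR S (n + 1 - 1) t := by rw [hn]; exact h2
  rw [hy, he, extR, dif_pos h3, rd_apply] at h1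
  exact h1.symm

theorem bd_cone [Fintype α] {b : α} (hb : IsMax b) (f k : Finset α → ℤ)
    (hk : ∀ s, b ∈ s → k s = 0) (hfk : ∀ s, b ∉ s → k s = f (insert b s))
    (t : Finset α) (ht : b ∉ t) : bd k t = bd f (insert b t) := by
  unfold bd
  refine Finset.sum_congr rfl fun v _ => ?_
  by_cases hv : v ∈ t
  · simp [hv]
  · by_cases hvb : v = b
    · subst hvb
      simp [hk]
    · have h1 : b ∉ insert v t := by simp [ht, Ne.symm hvb]
      have h2 : v ∉ insert b t := by simp [hv, hvb]
      rw [if_pos hv, if_pos h2, hfk _ h1, sgn_insert t b v ht, if_neg hb.not_lt,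
        Finset.insert_comm]
      ring

theorem bd_single [Fintype α] (b : α) (f : Finset α → ℤ) (t : Finset α) (hb : b ∉ t)
    (h : ∀ v, v ∉ t → v ≠ b → f (insert v t) = 0) :
    bd f t = chainSgn α t b * f (insert b t) := by
  unfold bd
  rw [Finset.sum_eq_single b]
  · rw [if_pos hb]
  · intro v _ hv
    by_cases h1 : v ∈ t
    · simp [h1]
    · rw [if_pos h1, h v h1 hv, mul_zero]
  · simp

theorem chain_insert {b : α} {t : Finset α} (h : IsChain (· ≤ ·) (↑t : Set α))
    (hlt : ∀ x ∈ t, x ≠ b → x < b) : IsChain (· ≤ ·) (↑(insert b t) : Set α) := by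
  rw [Finset.coe_insert]
  exact h.insert fun x hx hne => Or.inr (hlt x hx (Ne.symm hne)).le

end Helpers


/-- Let `X` be a finite poset, `b` a maximal point, and `a` a point with `F̂_a = {b}` such
that `Û_b ∖ {a}` has trivial reduced f-homology in every degree.  Then
`H^f_n(X, X ∖ {a, b}) = 0` for all `n`. -/
theorem stmt4 {α : Type u} [PartialOrder α] [Fintype α] (b : α) (hb : IsMax b) (a : α)
    (ha : {y : α | a < y} = ({b} : Set α))
    (hadm : ∀ k : ℤ, Subsingleton (RH α ({y | y < b} \ {a}) k)) :
    ∀ n : ℤ, Subsingleton (FH α Set.univ (({a, b} : Set α)ᶜ) n) := by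
  intro n
  have hab : a < b := by
    have : b ∈ {y : α | a < y} := by rw [ha]; rfl
    exact this
  have hay : ∀ y, a < y → y = b := fun y hy => by
    have : y ∈ ({b} : Set α) := by rw [← ha]; exact hy
    exact this
  have hne : a ≠ b := hab.ne
  have lt_a : ∀ t : Finset α, IsChain (· ≤ ·) (↑t : Set α) → a ∈ t → ∀ x ∈ t, x ≠ b → x < b := by
    intro t hc hat x hx hxb
    by_cases hxa : x = a
    · rw [hxa]; exact hab
    rcases hc hx hat hxa with h | h
    · exact h.trans_lt hab
    · exact absurd (hay x (lt_of_le_of_ne h (Ne.symm hxa))) hxb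
  have lt_b : ∀ t : Finset α, IsChain (· ≤ ·) (↑t : Set α) → b ∈ t → ∀ x ∈ t, x ≠ b → x < b := by
    intro t hc hbt x hx hxb
    rcases hc hx hbt hxb with h | h
    · exact lt_of_le_of_ne h hxb
    · exact absurd (hb.eq_of_le h).symm hxb
  have hsub : ∀ t : Finset α, ¬ (↑t : Set α) ⊆ (({a, b} : Set α)ᶜ) ↔ a ∈ t ∨ b ∈ t := by
    intro t
    constructor
    · intro h
      by_contra h'
      push Not at h'
      apply h
      intro x hx hx'
      rcases hx' with rfl | hx'
      · exact h'.1 hx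
      · rw [Set.mem_singleton_iff] at hx'
        exact h'.2 (hx' ▸ hx)
    · rintro (h | h) h'
      · exact h' h (Or.inl rfl)
      · exact h' h (Or.inr rfl)
  have PFiff : ∀ (m : ℤ) (t : Finset α), PF Set.univ (({a, b} : Set α)ᶜ) m t ↔
      IsChain (· ≤ ·) (↑t : Set α) ∧ (t.card : ℤ) = m + 1 ∧ (a ∈ t ∨ b ∈ t) := by
    intro m t
    unfold PF
    rw [hsub]
    simp
  have PRiff : ∀ (m : ℤ) (t : Finset α), PR ({y | y < b} \ {a}) m t ↔
      b ∉ t ∧ a ∉ t ∧ PF Set.univ (({a, b} : Set α)ᶜ) (m + 1) (insert b t) := by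
    intro m t
    rw [PFiff]
    constructor
    · rintro ⟨h1, h2, h3⟩
      have hbt : b ∉ t := fun h => lt_irrefl b (h1 h).1
      refine ⟨hbt, fun h => (h1 h).2 rfl, chain_insert h2 fun x hx _ => (h1 hx).1, ?_, by simp⟩
      rw [Finset.card_insert_of_notMem hbt]; push_cast; omega
    · rintro ⟨hbt, hat, h1, h2, -⟩
      rw [Finset.card_insert_of_notMem hbt] at h2
      refine ⟨fun x hx => ⟨lt_b _ h1 (by simp) x (Finset.mem_insert_of_mem hx)
        (fun h => hbt (h ▸ hx)), fun h => hat ?_⟩, h1.mono (by simp), by push_cast at h2; omega⟩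
      rw [Set.mem_singleton_iff] at h
      exact h ▸ hx
  apply FH_of
  simp only [PFiff] at PRiff ⊢
  intro f hf hcyc
  -- first correction
  let g1 : Finset α → ℤ := fun s =>
    if a ∈ s ∧ b ∈ s then (-1) ^ (s.erase b).card * f (s.erase b) else 0
  have g1nz : ∀ s, g1 s ≠ 0 → (a ∈ s ∧ b ∈ s) ∧ f (s.erase b) ≠ 0 := by
    intro s hs
    by_cases h : a ∈ s ∧ b ∈ s
    · refine ⟨h, fun h0 => hs ?_⟩
      simp only [g1, if_pos h, h0, mul_zero]
    · exact absurd (if_neg h) hs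
  have hg1 : ∀ s, g1 s ≠ 0 → IsChain (· ≤ ·) (↑s : Set α) ∧ (s.card : ℤ) = n + 1 + 1 ∧
      (a ∈ s ∨ b ∈ s) := by
    intro s hs
    obtain ⟨⟨has, hbs⟩, hfs⟩ := g1nz s hs
    obtain ⟨h1, h2, -⟩ := hf _ hfs
    refine ⟨?_, ?_, Or.inl has⟩
    · have := chain_insert h1 (lt_a _ h1 (by simp [has, hne]))
      rwa [Finset.insert_erase hbs] at this
    · rw [← Finset.card_erase_add_one hbs]; push_cast; omega
  have bdg1 : ∀ t, bd g1 t ≠ 0 → IsChain (· ≤ ·) (↑t : Set α) ∧ (t.card : ℤ) = n + 1 ∧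
      (a ∈ t ∨ b ∈ t) := by
    intro t ht
    obtain ⟨v, -, hv⟩ := Finset.exists_ne_zero_of_sum_ne_zero ht
    have hvt : v ∉ t := by
      by_contra h
      simp [h] at hv
    rw [if_pos hvt] at hv
    have h0 := right_ne_zero_of_mul hv
    obtain ⟨h1, h2, -⟩ := hg1 _ h0
    obtain ⟨⟨h3, h4⟩, -⟩ := g1nz _ h0
    rw [Finset.card_insert_of_notMem hvt] at h2
    refine ⟨h1.mono (by simp), by push_cast at h2; omega, ?_⟩
    rw [Finset.mem_insert] at h3 h4
    rcases h3 with h3 | h3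
    · rcases h4 with h4 | h4
      · exact absurd (h3.trans h4.symm) hne
      · exact Or.inr h4
    · exact Or.inl h3
  let f' : Finset α → ℤ := fun s => f s - bd g1 s
  have hf' : ∀ s, f' s ≠ 0 → IsChain (· ≤ ·) (↑s : Set α) ∧ (s.card : ℤ) = n + 1 ∧
      (a ∈ s ∨ b ∈ s) := by
    intro s hs
    by_cases h : f s = 0
    · apply bdg1
      intro h'
      apply hs
      simp only [f', h, h', sub_zero]
    · exact hf s h
  have hcyc' : ∀ t : Finset α, IsChain (· ≤ ·) (↑t : Set α) ∧ (t.card : ℤ) = n - 1 + 1 ∧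
      (a ∈ t ∨ b ∈ t) → bd f' t = 0 := by
    intro t ht
    rw [bd_sub, hcyc t ht, bd_bd g1 (fun s hs => (hg1 s hs).1), sub_zero]
  have fa : ∀ t, a ∈ t → b ∉ t → f' t = 0 := by
    intro t hat hbt
    have h1 : bd g1 t = chainSgn α t b * g1 (insert b t) := by
      apply bd_single b g1 t hbt
      intro v hv hvb
      apply if_neg
      simp [hbt, Ne.symm hvb]
    have h2 : g1 (insert b t) = (-1) ^ t.card * f t := by
      simp only [g1]
      rw [if_pos (by simp [hat]), Finset.erase_insert hbt]
    simp only [f']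
    rw [h1, h2]
    by_cases h0 : f t = 0
    · simp [h0]
    · have h3 : chainSgn α t b = (-1) ^ t.card := by
        unfold chainSgn
        rw [Finset.filter_true_of_mem]
        intro x hx
        exact lt_a t (hf t h0).1 hat x hx (fun h => hbt (h ▸ hx))
      rw [h3, ← mul_assoc, ← mul_pow]
      simp
  have fab : ∀ s, a ∈ s → f' s = 0 := by
    intro s has
    by_cases hbs : b ∈ s
    · by_contra h0
      obtain ⟨h1, h2, -⟩ := hf' s h0
      have hat : a ∈ s.erase b := by simp [has, hne]
      rw [← Finset.card_erase_add_one hbs] at h2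
      have h3 := hcyc' (s.erase b) ⟨h1.mono (by simp), by push_cast at h2; omega, Or.inl hat⟩
      rw [bd_single b f' _ (by simp) (fun v hv hvb => fa _ (by simp [has, hne])
        (by simp [Ne.symm hvb])), Finset.insert_erase hbs] at h3
      rcases mul_eq_zero.1 h3 with h | h
      · unfold chainSgn at h
        exact absurd h (pow_ne_zero _ (by norm_num))
      · exact h0 h
    · exact fa s has hbs
  let h : Finset α → ℤ := fun t => if b ∈ t then 0 else f' (insert b t)
  have hbdh : ∀ t, b ∉ t → bd h t = bd f' (insert b t) :=
    bd_cone hb f' h (fun s hs => if_pos hs) (fun s hs => if_neg hs)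
  obtain ⟨k, hk, hk'⟩ := of_RH (hadm (n - 1)) h (by
    intro s hs
    have hbs : b ∉ s := fun h' => hs (if_pos h')
    have hs' : f' (insert b s) ≠ 0 := by
      simpa only [h, if_neg hbs] using hs
    rw [PRiff]
    refine ⟨hbs, fun has => hs' (fab _ (by simp [has])), ?_⟩
    rw [sub_add_cancel]
    exact hf' _ hs') (by
    intro t ht
    rw [PRiff] at ht
    rw [hbdh t ht.1]
    apply hcyc'
    have := ht.2.2
    rwa [sub_add_cancel] at this)
  let g2 : Finset α → ℤ := fun s => if b ∈ s then k (s.erase b) else 0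
  have hg2 : ∀ s, g2 s ≠ 0 → a ∉ s ∧ IsChain (· ≤ ·) (↑s : Set α) ∧ (s.card : ℤ) = n + 1 + 1 ∧
      (a ∈ s ∨ b ∈ s) := by
    intro s hs
    have hbs : b ∈ s := by
      by_contra h'
      exact hs (if_neg h')
    have hs' : k (s.erase b) ≠ 0 := by
      simpa only [g2, if_pos hbs] using hs
    have := hk _ hs'
    rw [PRiff, sub_add_cancel, Finset.insert_erase hbs] at this
    exact ⟨fun has => this.2.1 (by simp [has, hne]), this.2.2⟩
  have hbdk : ∀ t, b ∉ t → bd k t = bd g2 (insert b t) := by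
    apply bd_cone hb g2 k
    · intro s hs
      by_contra h0
      have := hk _ h0
      rw [PRiff] at this
      exact this.1 hs
    · intro s hs
      simp only [g2]
      rw [if_pos (by simp), Finset.erase_insert hs]
  refine ⟨fun s => g1 s + g2 s, ?_, ?_⟩
  · intro s hs
    by_cases h1 : g1 s = 0
    · by_cases h2 : g2 s = 0
      · exact absurd (by simp only [h1, h2, add_zero]) hs
      · exact (hg2 s h2).2
    · exact hg1 s h1
  · intro t ht
    rw [bd_add]
    suffices hh : bd g2 t = f' t by
      rw [hh]; simp only [f']; ring
    by_cases hat : a ∈ t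
    · rw [fab t hat]
      unfold bd
      refine Finset.sum_eq_zero fun v _ => ?_
      have : g2 (insert v t) = 0 := by
        by_contra h0
        exact (hg2 _ h0).1 (by simp [hat])
      rw [this]; simp
    · have hbt : b ∈ t := ht.2.2.resolve_left hat
      have e := Finset.insert_erase hbt
      have hPR : PR ({y | y < b} \ {a}) (n - 1) (t.erase b) := by
        rw [PRiff, sub_add_cancel, e]
        exact ⟨by simp, by simp [hat], ht⟩
      have h1 := hk' _ hPR
      rw [hbdk _ (by simp), e] at h1
      rw [h1]
      simp only [h]
      rw [if_neg (by simp), e]
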